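/- arXiv:1706.06980 — 5 statements merged into one kernel-verified Lean document; each statement's English description precedes it below -/
import Mathlib

section
/- There exists a constant $c > 0$ (one may take $c = 1/4$), independent of $n$, such that for every integer $n \ge 1$ and every $u = (u_1,\dots,u_n) \in \mathbb{R}^n$, $\sum_{j=1}^{n} \Big( \sum_{i=j}^{n} u_i \Big)^2 \ge c \sum_{j=1}^n u_j^2$. Equivalently, the smallest eigenvalue of $G^T G$, where $G$ is the $n \times n$ upper triangular matrix with all entries on and above the diagonal equal to $1$, is bounded below by a positive constant independent of $n$. -/
theorem sum_sq_add_two_mul_sq_sum_le_four_mul_sum_sq_tail_sums (n : ℕ) (u : Fin n → ℝ) :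
    ∑ j, u j ^ 2 + 2 * (∑ j, u j) ^ 2 ≤
      4 * ∑ j : Fin n, (∑ i ∈ Finset.univ.filter (fun i : Fin n => j ≤ i), u i) ^ 2 := by
  induction n with
  | zero => simp
  | succ n ih =>
    have h := ih (fun i => u i.succ)
    simp only [Finset.sum_filter] at h ⊢
    simp only [Fin.sum_univ_succ (n := n), Fin.zero_le, if_true, Fin.succ_le_succ_iff,
      Fin.le_zero_iff, Fin.succ_ne_zero, if_false, zero_add]
    nlinarith [sq_nonneg (u 0 + 2 * ∑ j : Fin n, u j.succ)]

/-- There is a constant `c > 0` independent of `n` (one may take `c = 1/4`)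
such that for every `n ≥ 1` and `u ∈ ℝⁿ`,
`∑_{j=1}^n (∑_{i=j}^n u_i)² ≥ c ∑_{j=1}^n u_j²`; i.e. the smallest eigenvalue of `GᵀG`
for the upper-triangular all-ones matrix `G` is bounded below uniformly in `n`. -/
theorem tail_sums_quadratic_form_lower_bound :
    ∃ c : ℝ, 0 < c ∧ c = 1 / 4 ∧
      ∀ (n : ℕ), 1 ≤ n → ∀ u : Fin n → ℝ,
        c * ∑ j, u j ^ 2 ≤
          ∑ j : Fin n, (∑ i ∈ Finset.univ.filter (fun i : Fin n => j ≤ i), u i) ^ 2 := by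
  refine ⟨1 / 4, by norm_num, rfl, fun n _ u => ?_⟩
  have h := sum_sq_add_two_mul_sq_sum_le_four_mul_sum_sq_tail_sums n u
  linarith [sq_nonneg (∑ j, u j)]
end

section
/- Let $H \in (0,1)$. There exists a constant $K = K(H) > 0$, independent of $n$, such that for every integer $n \ge 1$ and all times $0 < s_1 < s_2 < \cdots < s_n$, the smallest eigenvalue of the matrix $Q = \big(\frac{1}{2}(s_j^{2H}+s_k^{2H}-|s_j-s_k|^{2H})\big)_{1 \le j,k \le n}$ satisfies $\lambda_{\min}(Q) \ge K \min\{s_1^{2H}, (s_2-s_1)^{2H}, \dots, (s_n - s_{n-1})^{2H}\}$. -/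
open Matrix

/-- The smallest eigenvalue of a symmetric real matrix, characterized variationally as
`inf {uᵀQu : ‖u‖₂ = 1}`. -/
noncomputable def lambdaMin {n : ℕ} (Q : Matrix (Fin n) (Fin n) ℝ) : ℝ :=
  sInf {r : ℝ | ∃ u : Fin n → ℝ, ∑ i, u i ^ 2 = 1 ∧ r = u ⬝ᵥ (Q *ᵥ u)}

open MeasureTheory Set in
theorem integrableOn_exp_neg_mul_cos {a : ℝ} (ha : 0 < a) (b : ℝ) :
    IntegrableOn (fun v : ℝ => Real.exp (-a * v) * Real.cos (b * v)) (Ioi 0) := by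
  have h := (integrableOn_exp_mul_complex_Ioi (a := ⟨-a, b⟩) (by simpa using ha) 0).re
  refine h.congr (Filter.Eventually.of_forall fun v => ?_)
  simp [Complex.exp_re]

open MeasureTheory Set in
theorem integral_exp_neg_mul_cos {a : ℝ} (ha : 0 < a) (b : ℝ) :
    ∫ v in Ioi (0 : ℝ), Real.exp (-a * v) * Real.cos (b * v) = a / (a ^ 2 + b ^ 2) := by
  have hre : (⟨-a, b⟩ : ℂ).re < 0 := by simpa using ha
  have h := integral_re (𝕜 := ℂ) (integrableOn_exp_mul_complex_Ioi hre 0)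
  rw [integral_exp_mul_complex_Ioi hre 0] at h
  have hab : a ^ 2 + b ^ 2 ≠ 0 := by positivity
  simp only [RCLike.re_to_complex, Complex.exp_re, Complex.mul_re, Complex.mul_im,
    Complex.ofReal_re, Complex.ofReal_im, mul_zero, sub_zero, zero_add, Complex.ofReal_zero,
    Complex.exp_zero, Complex.div_re, Complex.neg_re, Complex.neg_im, Complex.one_re,
    Complex.one_im, Complex.normSq_mk] at h
  rw [h]
  field_simp
  ring

theorem sum_sum_mul_cos_sub {ι : Type*} [Fintype ι] (u x : ι → ℝ) :
    ∑ j, ∑ k, u j * u k * Real.cos (x j - x k) =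
      (∑ j, u j * Real.cos (x j)) ^ 2 + (∑ j, u j * Real.sin (x j)) ^ 2 := by
  simp only [sq, Finset.sum_mul_sum, ← Finset.sum_add_distrib, Real.cos_sub]
  exact Finset.sum_congr rfl fun j _ => Finset.sum_congr rfl fun k _ => by ring

open MeasureTheory Set in
/-- The Cauchy kernel is positive semidefinite. -/
theorem cauchy_kernel_sum_nonneg {ι : Type*} [Fintype ι] (u x : ι → ℝ) {s : ℝ} (hs : 0 < s) :
    0 ≤ ∑ j, ∑ k, u j * u k * (s + (x j - x k) ^ 2)⁻¹ := by
  obtain ⟨a, ha, rfl⟩ : ∃ a : ℝ, 0 < a ∧ s = a ^ 2 :=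
    ⟨√s, Real.sqrt_pos.2 hs, (Real.sq_sqrt hs.le).symm⟩
  have hint (b : ℝ) := integrableOn_exp_neg_mul_cos ha b
  have key : ∑ j, ∑ k, u j * u k * (a ^ 2 + (x j - x k) ^ 2)⁻¹ =
      a⁻¹ * ∫ v in Ioi (0 : ℝ), ∑ j, ∑ k,
        u j * u k * (Real.exp (-a * v) * Real.cos ((x j - x k) * v)) := by
    rw [integral_finsetSum _ fun j _ => integrable_finsetSum _ fun k _ => (hint _).const_mul _,
      Finset.mul_sum]
    refine Finset.sum_congr rfl fun j _ => ?_
    rw [integral_finsetSum _ fun k _ => (hint _).const_mul _, Finset.mul_sum]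
    refine Finset.sum_congr rfl fun k _ => ?_
    rw [integral_const_mul, integral_exp_neg_mul_cos ha]
    field_simp
  rw [key]
  refine mul_nonneg (inv_nonneg.2 ha.le) (integral_nonneg fun v => ?_)
  have h : ∑ j, ∑ k, u j * u k * (Real.exp (-a * v) * Real.cos ((x j - x k) * v)) =
      Real.exp (-a * v) * ∑ j, ∑ k, u j * u k * Real.cos (x j * v - x k * v) := by
    simp only [Finset.mul_sum]
    exact Finset.sum_congr rfl fun j _ => Finset.sum_congr rfl fun k _ => by
      rw [sub_mul]; ring
  change 0 ≤ ∑ j, ∑ k, u j * u k * (Real.exp (-a * v) * Real.cos ((x j - x k) * v))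
  rw [h, sum_sum_mul_cos_sub]
  positivity

/-- A symmetric matrix with diagonal entries at least `2 * c` and absolute off-diagonal row sums
at most `c` is bounded below by `c`. -/
theorem le_quadratic_form_of_diagonally_dominant {ι : Type*} [Fintype ι] [DecidableEq ι]
    (M : ι → ι → ℝ) (hM : ∀ j k, M j k = M k j) (c : ℝ) (hdiag : ∀ j, 2 * c ≤ M j j)
    (hoff : ∀ j, ∑ k, (if j = k then 0 else |M j k|) ≤ c) (u : ι → ℝ) :
    c * ∑ j, u j ^ 2 ≤ ∑ j, ∑ k, u j * u k * M j k := by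
  set A : ι → ι → ℝ := fun j k => if j = k then 0 else |M j k| with hA
  have hAsymm (j k) : A j k = A k j := by simp only [hA, hM j k, eq_comm]
  have hterm (j k) : (if j = k then u j ^ 2 * (2 * c) else 0)
      - (u j ^ 2 * A j k + u k ^ 2 * A k j) / 2 ≤ u j * u k * M j k := by
    rw [hAsymm k j]
    by_cases h : j = k
    · subst h
      simp only [hA, if_true]
      nlinarith [mul_le_mul_of_nonneg_left (hdiag j) (sq_nonneg (u j))]
    · simp only [hA, h, if_false]
      have h1 := neg_abs_le (u j * u k * M j k)
      rw [abs_mul, abs_mul] at h1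
      rw [← sq_abs (u j), ← sq_abs (u k)]
      nlinarith [mul_nonneg (sq_nonneg (|u j| - |u k|)) (abs_nonneg (M j k))]
  have hsum := Finset.sum_le_sum fun j (_ : j ∈ Finset.univ) =>
    Finset.sum_le_sum fun k (_ : k ∈ Finset.univ) => hterm j k
  refine le_trans ?_ hsum
  have hcomm : ∑ j, ∑ k, u k ^ 2 * A k j = ∑ j, ∑ k, u j ^ 2 * A j k := Finset.sum_comm
  simp only [Finset.sum_sub_distrib, Finset.sum_ite_eq, Finset.mem_univ, if_true,
    ← Finset.sum_div, Finset.sum_add_distrib, hcomm]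
  simp only [← Finset.mul_sum, ← Finset.sum_mul]
  have hrow : ∑ j, u j ^ 2 * ∑ k, A j k ≤ (∑ j, u j ^ 2) * c := by
    rw [Finset.sum_mul]
    exact Finset.sum_le_sum fun j _ => mul_le_mul_of_nonneg_left (hoff j) (sq_nonneg _)
  linarith

theorem sum_one_div_sub_sq_le {m : ℕ} (j : Fin m) :
    ∑ k : Fin m, 1 / ((((k : ℤ) - (j : ℤ) : ℤ) : ℝ)) ^ 2 ≤ ∑' i : ℤ, 1 / (i : ℝ) ^ 2 := by
  have hinj : Function.Injective fun k : Fin m => (k : ℤ) - (j : ℤ) := fun k l h => by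
    simp only at h; omega
  rw [← tsum_fintype (L := .unconditional _)]
  exact (Summable.of_finite).tsum_le_tsum_of_inj _ hinj (fun _ _ => by positivity)
    (fun _ => le_rfl) (Real.summable_one_div_int_pow.2 one_lt_two)

/-- On `δ`-separated points, the Cauchy kernel of small width is bounded below by a multiple of
the identity. -/
theorem le_cauchy_kernel_sum {m : ℕ} (u x : Fin m → ℝ) {δ s : ℝ} (hδ : 0 < δ) (hs : 0 < s)
    (hsep : ∀ j k : Fin m, δ * |(((k : ℤ) - (j : ℤ) : ℤ) : ℝ)| ≤ |x j - x k|)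
    (hsδ : s * (2 * ∑' i : ℤ, 1 / (i : ℝ) ^ 2) ≤ δ ^ 2) :
    s⁻¹ / 2 * ∑ j, u j ^ 2 ≤ ∑ j, ∑ k, u j * u k * (s + (x j - x k) ^ 2)⁻¹ := by
  refine le_quadratic_form_of_diagonally_dominant (fun j k => (s + (x j - x k) ^ 2)⁻¹)
    (fun j k => by rw [← neg_sub, neg_sq]) _ (fun j => by simp; linarith) (fun j => ?_) u
  have hle : ∑ k, (if j = k then 0 else |(s + (x j - x k) ^ 2)⁻¹|) ≤
      (δ ^ 2)⁻¹ * ∑ k : Fin m, 1 / ((((k : ℤ) - (j : ℤ) : ℤ) : ℝ)) ^ 2 := by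
    rw [Finset.mul_sum]
    refine Finset.sum_le_sum fun k _ => ?_
    split_ifs with hjk
    · positivity
    · have hne : (((k : ℤ) - (j : ℤ) : ℤ) : ℝ) ≠ 0 := by
        rw [Int.cast_ne_zero]; omega
      have h := pow_le_pow_left₀ (by positivity) (hsep j k) 2
      rw [mul_pow, sq_abs, sq_abs] at h
      rw [abs_of_nonneg (by positivity), one_div, ← mul_inv]
      exact inv_anti₀ (by positivity) (by linarith)
  refine hle.trans ((mul_le_mul_of_nonneg_left (sum_one_div_sub_sq_le j)
    (by positivity)).trans ?_)
  rw [inv_mul_le_iff₀ (by positivity), inv_eq_one_div, div_div, mul_one_div,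
    le_div_iff₀ (by positivity)]
  linarith

open MeasureTheory Set Real in
/-- A lower bound for the conditionally negative definite kernel `|x - y| ^ (2 * H)` on
`δ`-separated points. -/
theorem exists_le_neg_sum_rpow {H : ℝ} (hH : H ∈ Ioo (0 : ℝ) 1) :
    ∃ K : ℝ, 0 < K ∧ ∀ (m : ℕ) (u x : Fin m → ℝ) (δ : ℝ), 0 < δ →
      (∀ j k : Fin m, δ * |(((k : ℤ) - (j : ℤ) : ℤ) : ℝ)| ≤ |x j - x k|) → ∑ j, u j = 0 →
      K * δ ^ (2 * H) * ∑ j, u j ^ 2 ≤ -∑ j, ∑ k, u j * u k * |x j - x k| ^ (2 * H) := by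
  set S : ℝ := ∑' i : ℤ, 1 / (i : ℝ) ^ 2
  have hS : 0 ≤ S := tsum_nonneg fun i => by positivity
  set C : ℝ := ∫ t in Ioi 0, rpowIntegrand₀₁ H t 1
  have hC : 0 < C := integral_rpowIntegrand₀₁_one_pos hH
  refine ⟨C⁻¹ * ((1 / (2 * S + 1)) ^ H / (2 * H)), ?_, fun m u x δ hδ hsep hu => ?_⟩
  · have := hH.1
    positivity
  have hH0 := hH.1
  have hpow (y : ℝ) : |y| ^ (2 * H) = C⁻¹ * ∫ t in Ioi 0, rpowIntegrand₀₁ H t (y ^ 2) := by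
    rw [rpow_mul (abs_nonneg y), rpow_two, sq_abs]
    exact rpow_eq_const_mul_integral hH (sq_nonneg y)
  have hint (y : ℝ) := integrableOn_rpowIntegrand₀₁_Ioi hH (sq_nonneg y)
  set F : ℝ → ℝ := fun t => -∑ j, ∑ k, u j * u k * rpowIntegrand₀₁ H t ((x j - x k) ^ 2) with hF
  have hFint : IntegrableOn F (Ioi 0) :=
    (integrable_finsetSum _ fun j _ => integrable_finsetSum _ fun k _ =>
      (hint _).const_mul _).neg
  have hrepr : -∑ j, ∑ k, u j * u k * |x j - x k| ^ (2 * H) = C⁻¹ * ∫ t in Ioi 0, F t := by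
    simp only [hF]
    rw [integral_neg, mul_neg, integral_finsetSum _ fun j _ => integrable_finsetSum _ fun k _ =>
      (hint _).const_mul _, Finset.mul_sum]
    congr 1
    refine Finset.sum_congr rfl fun j _ => ?_
    rw [integral_finsetSum _ fun k _ => (hint _).const_mul _, Finset.mul_sum]
    refine Finset.sum_congr rfl fun k _ => ?_
    rw [integral_const_mul, hpow]
    ring
  have hFeq (t : ℝ) : F t = t ^ H * ∑ j, ∑ k, u j * u k * (t + (x j - x k) ^ 2)⁻¹ := by
    have h0 : ∑ j, ∑ k, u j * u k * (t ^ H * t⁻¹) = 0 := by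
      simp only [← Finset.sum_mul, ← Finset.mul_sum, hu, mul_zero, zero_mul,
        Finset.sum_const_zero]
    simp only [hF, rpowIntegrand₀₁, mul_sub, Finset.sum_sub_distrib, h0, zero_sub, neg_neg,
      Finset.mul_sum]
    exact Finset.sum_congr rfl fun j _ => Finset.sum_congr rfl fun k _ => by ring
  set T : ℝ := δ ^ 2 * (1 / (2 * S + 1)) with hT
  have hT0 : 0 < T := by positivity
  have hpi : IntegrableOn (fun t : ℝ => t ^ (H - 1)) (Ioc 0 T) :=
    (intervalIntegrable_iff_integrableOn_Ioc_of_le hT0.le).1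
      (intervalIntegral.intervalIntegrable_rpow' (by linarith))
  have hlow : T ^ H / (2 * H) * ∑ j, u j ^ 2 ≤ ∫ t in Ioi 0, F t := by
    calc T ^ H / (2 * H) * ∑ j, u j ^ 2
        = ∫ t in Ioc 0 T, t ^ (H - 1) * ((∑ j, u j ^ 2) / 2) := by
          rw [integral_mul_const, ← intervalIntegral.integral_of_le hT0.le,
            integral_rpow (Or.inl (by linarith)), sub_add_cancel, zero_rpow hH0.ne']
          ring
      _ ≤ ∫ t in Ioc 0 T, F t := by
          refine setIntegral_mono_on (hpi.mul_const _) (hFint.mono_set Ioc_subset_Ioi_self)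
            measurableSet_Ioc fun t ht => ?_
          have hts : t * (2 * S) ≤ δ ^ 2 := by
            have h1 : T * (2 * S + 1) = δ ^ 2 := by rw [hT]; field_simp
            nlinarith [mul_le_mul_of_nonneg_right ht.2 hS, hT0]
          rw [hFeq, rpow_sub_one ht.1.ne']
          calc t ^ H / t * ((∑ j, u j ^ 2) / 2) = t ^ H * (t⁻¹ / 2 * ∑ j, u j ^ 2) := by ring
            _ ≤ _ := mul_le_mul_of_nonneg_left (le_cauchy_kernel_sum u x hδ ht.1 hsep hts)
              (rpow_nonneg ht.1.le _)
      _ ≤ ∫ t in Ioi 0, F t := by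
          refine setIntegral_mono_set hFint ?_ Ioc_subset_Ioi_self.eventuallyLE
          refine (ae_restrict_iff' measurableSet_Ioi).2 (Filter.Eventually.of_forall fun t ht => ?_)
          rw [hFeq]
          exact mul_nonneg (rpow_nonneg (le_of_lt ht) _) (cauchy_kernel_sum_nonneg u x ht)
  have hTH : T ^ H = δ ^ (2 * H) * (1 / (2 * S + 1)) ^ H := by
    rw [hT, mul_rpow (by positivity) (by positivity), rpow_mul hδ.le, rpow_two]
  rw [hrepr]
  refine le_trans (le_of_eq ?_) (mul_le_mul_of_nonneg_left hlow (inv_nonneg.2 hC.le))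
  rw [hTH]
  ring

theorem mul_sub_le_of_forall_le_sub {n : ℕ} {t : ℕ → ℝ} {δ : ℝ}
    (h : ∀ j < n, δ ≤ t (j + 1) - t j) {a b : ℕ} (hab : a ≤ b) (hb : b ≤ n) :
    δ * ((b : ℝ) - a) ≤ t b - t a := by
  induction b, hab using Nat.le_induction with
  | base => simp
  | succ b hab ih =>
    have h1 := ih (by omega)
    have h2 := h b (by omega)
    push_cast
    linarith

/-- For `H ∈ (0,1)` there is `K = K(H) > 0`, independent of `n`, such that
for all times `0 = t 0 < t 1 < ⋯ < t n`, the smallest eigenvalue of the fBm covariance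
matrix `Q_{jk} = (t_j^{2H} + t_k^{2H} - |t_j - t_k|^{2H})/2` (indices `1,…,n`) satisfies
`λ_min(Q) ≥ K min_j (t_j - t_{j-1})^{2H}`. -/
theorem fbm_covariance_lambdaMin_lower_bound
    (H : ℝ) (hH : H ∈ Set.Ioo (0:ℝ) 1) :
    ∃ K : ℝ, 0 < K ∧
      ∀ (n : ℕ), 1 ≤ n → ∀ t : ℕ → ℝ, t 0 = 0 → (∀ j < n, t j < t (j + 1)) →
        K * ⨅ j : Fin n, (t ((j : ℕ) + 1) - t (j : ℕ)) ^ (2 * H) ≤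
          lambdaMin (Matrix.of fun j k : Fin n =>
            ((t ((j : ℕ) + 1)) ^ (2 * H) + (t ((k : ℕ) + 1)) ^ (2 * H)
              - |t ((j : ℕ) + 1) - t ((k : ℕ) + 1)| ^ (2 * H)) / 2) := by
  obtain ⟨K, hK, hmain⟩ := exists_le_neg_sum_rpow hH
  refine ⟨K / 2, by positivity, fun n hn t ht0 ht => ?_⟩
  have hH0 : 0 < 2 * H := by linarith [hH.1]
  have : Nonempty (Fin n) := ⟨⟨0, hn⟩⟩
  obtain ⟨i, hi⟩ := Finite.exists_min fun j : Fin n => t ((j : ℕ) + 1) - t (j : ℕ)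
  set δ : ℝ := t ((i : ℕ) + 1) - t (i : ℕ) with hδdef
  have hδ : 0 < δ := sub_pos.2 (ht i i.2)
  have hinf : ⨅ j : Fin n, (t ((j : ℕ) + 1) - t (j : ℕ)) ^ (2 * H) ≤ δ ^ (2 * H) :=
    ciInf_le (Set.finite_range _).bddBelow i
  have hmono {a b : ℕ} (hab : a ≤ b) (hb : b ≤ n) : δ * ((b : ℝ) - a) ≤ t b - t a :=
    mul_sub_le_of_forall_le_sub (fun j hj => hi ⟨j, hj⟩) hab hb
  have hsep (j k : Fin (n + 1)) :
      δ * |(((k : ℤ) - (j : ℤ) : ℤ) : ℝ)| ≤ |t j - t k| := by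
    push_cast
    rcases le_total (j : ℕ) k with h | h
    · rw [abs_of_nonneg (sub_nonneg.2 (by exact_mod_cast h)), abs_sub_comm]
      exact (hmono h (by omega)).trans (le_abs_self _)
    · rw [abs_sub_comm, abs_of_nonneg (sub_nonneg.2 (by exact_mod_cast h))]
      exact (hmono h (by omega)).trans (le_abs_self _)
  have hpos (j : Fin n) : 0 ≤ t ((j : ℕ) + 1) := by
    have h := hmono (Nat.zero_le ((j : ℕ) + 1)) j.2
    rw [ht0, sub_zero] at h
    refine le_trans ?_ h
    rw [Nat.cast_zero, sub_zero]
    positivity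
  refine le_csInf ?_ ?_
  · exact ⟨_, Pi.single i 1, by simp [Pi.single_apply], rfl⟩
  rintro r ⟨u, hu, rfl⟩
  have h := hmain (n + 1) (Fin.cons (-∑ j, u j) u) (fun j => t j) δ hδ hsep
    (by simp [Fin.sum_univ_succ])
  have hK1 : K * ⨅ j : Fin n, (t ((j : ℕ) + 1) - t (j : ℕ)) ^ (2 * H) ≤ K * δ ^ (2 * H) :=
    mul_le_mul_of_nonneg_left hinf hK.le
  have hK2 : K * δ ^ (2 * H) ≤
      K * δ ^ (2 * H) * ∑ j, (Fin.cons (-∑ j, u j) u : Fin (n + 1) → ℝ) j ^ 2 := by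
    refine le_mul_of_one_le_right (by positivity) ?_
    simp only [Fin.sum_univ_succ, Fin.cons_zero, Fin.cons_succ, hu]
    linarith [sq_nonneg (-∑ j, u j)]
  have hQ : -∑ j, ∑ k, (Fin.cons (-∑ j, u j) u : Fin (n + 1) → ℝ) j *
        (Fin.cons (-∑ j, u j) u : Fin (n + 1) → ℝ) k * |t j - t k| ^ (2 * H) =
      2 * (u ⬝ᵥ ((Matrix.of fun j k : Fin n =>
            ((t ((j : ℕ) + 1)) ^ (2 * H) + (t ((k : ℕ) + 1)) ^ (2 * H)
              - |t ((j : ℕ) + 1) - t ((k : ℕ) + 1)| ^ (2 * H)) / 2) *ᵥ u)) := by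
    have h1 : ∑ j : Fin n, ∑ k : Fin n, u j * u k * t ((j : ℕ) + 1) ^ (2 * H) =
        (∑ k, u k) * ∑ j : Fin n, u j * t ((j : ℕ) + 1) ^ (2 * H) := by
      rw [Finset.sum_mul_sum, Finset.sum_comm]
      exact Finset.sum_congr rfl fun j _ => Finset.sum_congr rfl fun k _ => by ring
    have h2 : ∑ j : Fin n, ∑ k : Fin n, u j * u k * t ((k : ℕ) + 1) ^ (2 * H) =
        (∑ k, u k) * ∑ j : Fin n, u j * t ((j : ℕ) + 1) ^ (2 * H) := by
      rw [Finset.sum_mul_sum]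
      exact Finset.sum_congr rfl fun j _ => Finset.sum_congr rfl fun k _ => by ring
    have h3 : 2 * (u ⬝ᵥ ((Matrix.of fun j k : Fin n =>
            ((t ((j : ℕ) + 1)) ^ (2 * H) + (t ((k : ℕ) + 1)) ^ (2 * H)
              - |t ((j : ℕ) + 1) - t ((k : ℕ) + 1)| ^ (2 * H)) / 2) *ᵥ u)) =
        ∑ j : Fin n, ∑ k : Fin n, u j * u k * t ((j : ℕ) + 1) ^ (2 * H) +
        ∑ j : Fin n, ∑ k : Fin n, u j * u k * t ((k : ℕ) + 1) ^ (2 * H) -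
        ∑ j : Fin n, ∑ k : Fin n,
          u j * u k * |t ((j : ℕ) + 1) - t ((k : ℕ) + 1)| ^ (2 * H) := by
      simp only [dotProduct, Matrix.mulVec, Matrix.of_apply, Finset.mul_sum,
        ← Finset.sum_add_distrib, ← Finset.sum_sub_distrib]
      exact Finset.sum_congr rfl fun j _ => Finset.sum_congr rfl fun k _ => by ring
    have h4 (c : ℝ) : ∑ j : Fin n, c * u j * t ((j : ℕ) + 1) ^ (2 * H) =
        c * ∑ j : Fin n, u j * t ((j : ℕ) + 1) ^ (2 * H) := by
      rw [Finset.mul_sum]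
      exact Finset.sum_congr rfl fun j _ => by ring
    have h5 (c : ℝ) : ∑ j : Fin n, u j * c * t ((j : ℕ) + 1) ^ (2 * H) =
        c * ∑ j : Fin n, u j * t ((j : ℕ) + 1) ^ (2 * H) := by
      rw [Finset.mul_sum]
      exact Finset.sum_congr rfl fun j _ => by ring
    rw [h3, h1, h2]
    simp only [Fin.sum_univ_succ, Fin.cons_zero, Fin.cons_succ, Fin.val_zero, Fin.val_succ, ht0,
      abs_zero, Real.zero_rpow hH0.ne', mul_zero, zero_sub, abs_neg, sub_zero, zero_add,
      abs_of_nonneg (hpos _), Finset.sum_add_distrib, h4, h5]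
    ring
  rw [hQ] at h
  linarith
end

section
/- Let $H \in (0,1)$. There exists a constant $C = C(H) > 0$, independent of $n$, such that for every integer $n \ge 1$ and all times $0 < s_1 < s_2 < \cdots < s_n$, the determinant of the matrix $Q = \big(\frac{1}{2}(s_j^{2H}+s_k^{2H}-|s_j-s_k|^{2H})\big)_{1 \le j,k \le n}$ satisfies $\det(Q) \ge C^n\, s_1^{2H} (s_2 - s_1)^{2H} \cdots (s_n - s_{n-1})^{2H}$. -/
open Matrix

/-- If the quadratic form of a symmetric matrix dominates `c` times the square of the last
coordinate, its determinant dominates `c` times the leading principal minor. -/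
theorem mul_det_submatrix_castSucc_le_det {n : ℕ} {M : Matrix (Fin (n + 1)) (Fin (n + 1)) ℝ}
    (hM : M.IsSymm) {c : ℝ} (hc : ∀ x, c * x (Fin.last n) ^ 2 ≤ x ⬝ᵥ M *ᵥ x) :
    c * (M.submatrix Fin.castSucc Fin.castSucc).det ≤ M.det := by
  set e := Matrix.single (Fin.last n) (Fin.last n) c
  have hpsd : (M - e).PosSemidef := by
    refine PosSemidef.of_dotProduct_mulVec_nonneg ?_ fun x => ?_
    · have he : eᵀ = e := by simp [e]
      rw [IsHermitian, conjTranspose_eq_transpose_of_trivial, transpose_sub, hM.eq, he]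
    · have he : x ⬝ᵥ e *ᵥ x = c * x (Fin.last n) ^ 2 := by
        simp [e, single_mulVec, Function.update_apply, dotProduct]
        ring
      rw [star_trivial, sub_mulVec, dotProduct_sub, he]
      linarith [hc x]
  have hdet : (M - e).det = M.det - c * (M.submatrix Fin.castSucc Fin.castSucc).det := by
    have hrow : M - e = M.updateRow (Fin.last n)
        (M (Fin.last n) + (-c) • Pi.single (Fin.last n) (1 : ℝ)) := by
      ext i j
      rcases eq_or_ne i (Fin.last n) with rfl | hi
      · rcases eq_or_ne j (Fin.last n) with rfl | hj
        · simp [e]; ring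
        · simp [e, hj, hj.symm]
      · simp [e, hi, hi.symm]
    have hminor := adjugate_fin_succ_eq_det_submatrix M (Fin.last n) (Fin.last n)
    rw [adjugate_apply] at hminor
    rw [hrow, det_updateRow_add, det_updateRow_smul, updateRow_eq_self, hminor]
    simp [← two_mul, pow_mul, Fin.succAbove_last]
    ring
  linarith [hpsd.det_nonneg]

open MeasureTheory Set

/-- The truncated power function `x ↦ x₊ ^ a`, with value `0` on `(-∞, 0]`. -/
noncomputable def truncPow (a x : ℝ) : ℝ := if 0 < x then x ^ a else 0

theorem truncPow_of_pos {a x : ℝ} (hx : 0 < x) : truncPow a x = x ^ a := if_pos hx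

theorem truncPow_of_nonpos {a x : ℝ} (hx : x ≤ 0) : truncPow a x = 0 := if_neg hx.not_gt

theorem measurable_truncPow (a : ℝ) : Measurable (truncPow a) :=
  Measurable.ite measurableSet_Ioi (by fun_prop) measurable_const

theorem truncPow_mul {a c : ℝ} (hc : 0 < c) (x : ℝ) :
    truncPow a (c * x) = c ^ a * truncPow a x := by
  rcases lt_or_ge 0 x with hx | hx
  · rw [truncPow_of_pos hx, truncPow_of_pos (mul_pos hc hx), Real.mul_rpow hc.le hx.le]
  · rw [truncPow_of_nonpos hx, truncPow_of_nonpos (mul_nonpos_of_nonneg_of_nonpos hc.le hx),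
      mul_zero]

theorem rpow_sq_eq {a x : ℝ} (hx : 0 ≤ x) : (x ^ a) ^ 2 = x ^ (2 * a) := by
  rw [mul_comm, Real.rpow_mul hx, Real.rpow_two]

theorem integrableOn_truncPow_sq {a : ℝ} (ha : -1 < 2 * a) (b : ℝ) :
    IntegrableOn (fun x => truncPow a x ^ 2) (Iic b) := by
  have hpos : IntegrableOn (fun x => truncPow a x ^ 2) (Ioc 0 (max b 0)) := by
    refine ((intervalIntegrable_iff_integrableOn_Ioc_of_le (le_max_right b 0)).1
      (intervalIntegral.intervalIntegrable_rpow' ha)).congr_fun (fun x hx => ?_) measurableSet_Ioc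
    simp only [truncPow_of_pos hx.1, rpow_sq_eq hx.1.le]
  have hneg : IntegrableOn (fun x => truncPow a x ^ 2) (Iic 0) :=
    integrableOn_zero.congr_fun (fun x hx => by simp [truncPow_of_nonpos hx]) measurableSet_Iic
  refine (hneg.union hpos).mono_set fun x hx => ?_
  rcases le_or_gt x 0 with h | h
  · exact Or.inl h
  · exact Or.inr ⟨h, le_max_of_le_left hx⟩

/-- The Mandelbrot–Van Ness kernel `(t - u)₊ ^ a - (s - u)₊ ^ a`. -/
noncomputable def mvnKernel (a s t u : ℝ) : ℝ := truncPow a (t - u) - truncPow a (s - u)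

theorem measurable_mvnKernel (a s t : ℝ) : Measurable (mvnKernel a s t) :=
  ((measurable_truncPow a).comp (measurable_const.sub measurable_id)).sub
    ((measurable_truncPow a).comp (measurable_const.sub measurable_id))

theorem abs_rpow_add_one_sub_rpow_le {a v : ℝ} (ha : a ≤ 1) (hv : 0 < v) :
    |(1 + v) ^ a - v ^ a| ≤ |a| * v ^ (a - 1) := by
  obtain ⟨c, hc, hslope⟩ := exists_hasDerivAt_eq_slope (fun x : ℝ => x ^ a)
    (fun x => a * x ^ (a - 1)) (show v < 1 + v by linarith)
    (fun x hx => (Real.continuousAt_rpow_const x a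
      (Or.inl (hv.trans_le hx.1).ne')).continuousWithinAt)
    (fun x hx => Real.hasDerivAt_rpow_const (Or.inl (hv.trans hx.1).ne'))
  rw [add_sub_cancel_right, div_one] at hslope
  rw [← hslope, abs_mul, abs_of_nonneg (Real.rpow_nonneg (hv.trans hc.1).le _)]
  exact mul_le_mul_of_nonneg_left
    (Real.rpow_le_rpow_of_nonpos hv hc.1.le (by linarith)) (abs_nonneg a)

theorem integrable_truncPow_add_one_sub_sq {a : ℝ} (ha : -1 < 2 * a) (ha' : 2 * a < 1) :
    Integrable fun v => (truncPow a (1 + v) - truncPow a v) ^ 2 := by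
  have hmeas : Measurable fun v => (truncPow a (1 + v) - truncPow a v) ^ 2 :=
    (((measurable_truncPow a).comp (measurable_const.add measurable_id)).sub
      (measurable_truncPow a)).pow_const 2
  rw [← integrableOn_univ, ← Iic_union_Ioi (a := (1 : ℝ))]
  refine IntegrableOn.union ?_ ?_
  · have hshift : IntegrableOn (fun v => truncPow a (1 + v) ^ 2) (Iic 1) := by
      have h := ((integrable_indicator_iff measurableSet_Iic).2
        (integrableOn_truncPow_sq ha 2)).comp_add_left 1
      rw [← integrable_indicator_iff measurableSet_Iic]
      refine h.congr (Filter.Eventually.of_forall fun v => ?_)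
      have : 1 + v ≤ 2 ↔ v ≤ 1 := by constructor <;> intro h <;> linarith
      simp [indicator_apply, this]
    refine ((hshift.add (integrableOn_truncPow_sq ha 1)).const_mul 2).mono'
      hmeas.aestronglyMeasurable (Filter.Eventually.of_forall fun v => ?_)
    rw [Real.norm_of_nonneg (sq_nonneg _)]
    simp only [Pi.add_apply]
    nlinarith [sq_nonneg (truncPow a (1 + v) + truncPow a v)]
  · refine ((integrableOn_Ioi_rpow_of_lt (a := 2 * (a - 1)) (by linarith)
      one_pos).const_mul (|a| ^ 2)).mono' hmeas.aestronglyMeasurable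
      ((ae_restrict_iff' measurableSet_Ioi).2 (Filter.Eventually.of_forall fun v hv => ?_))
    have hv : 0 < v := one_pos.trans hv
    rw [Real.norm_of_nonneg (sq_nonneg _), truncPow_of_pos hv, truncPow_of_pos (by linarith),
      ← rpow_sq_eq hv.le, ← mul_pow, ← sq_abs]
    exact pow_le_pow_left₀ (abs_nonneg _)
      (abs_rpow_add_one_sub_rpow_le (by linarith) hv) 2

theorem integrable_mvnKernel_zero_one_sq {a : ℝ} (ha : -1 < 2 * a) (ha' : 2 * a < 1) :
    Integrable fun u => mvnKernel a 0 1 u ^ 2 := by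
  simpa [mvnKernel, sub_eq_add_neg] using (integrable_truncPow_add_one_sub_sq ha ha').comp_neg

theorem mvnKernel_eq_scaled {a s t : ℝ} (hst : s < t) (u : ℝ) :
    mvnKernel a s t u = (t - s) ^ a * mvnKernel a 0 1 ((u - s) / (t - s)) := by
  have hpos : 0 < t - s := sub_pos.2 hst
  have ht : t - u = (t - s) * (1 - (u - s) / (t - s)) := by field_simp; ring
  have hs : s - u = (t - s) * (0 - (u - s) / (t - s)) := by field_simp; ring
  rw [mvnKernel, mvnKernel, ht, hs, truncPow_mul hpos, truncPow_mul hpos, mul_sub]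

theorem mvnKernel_sq_comm (a s t u : ℝ) : mvnKernel a s t u ^ 2 = mvnKernel a t s u ^ 2 := by
  rw [mvnKernel, mvnKernel, sub_sq_comm]

theorem integrable_mvnKernel_sq {a : ℝ} (ha : -1 < 2 * a) (ha' : 2 * a < 1) (s t : ℝ) :
    Integrable fun u => mvnKernel a s t u ^ 2 := by
  wlog hst : s < t generalizing s t
  · rcases (not_lt.1 hst).eq_or_lt with rfl | hts
    · simp [mvnKernel]
    · simpa only [mvnKernel_sq_comm a s t] using this t s hts
  simp_rw [mvnKernel_eq_scaled hst, mul_pow]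
  exact (((integrable_mvnKernel_zero_one_sq ha ha').comp_div
    (sub_pos.2 hst).ne').comp_sub_right s).const_mul _

theorem integral_mvnKernel_sq {a : ℝ} (ha : -1 < 2 * a) (s t : ℝ) :
    ∫ u, mvnKernel a s t u ^ 2 =
      |s - t| ^ (2 * a + 1) * ∫ u, mvnKernel a 0 1 u ^ 2 := by
  wlog hst : s < t generalizing s t
  · rcases (not_lt.1 hst).eq_or_lt with rfl | hts
    · simp [mvnKernel, Real.zero_rpow (show 2 * a + 1 ≠ 0 by linarith)]
    · simpa only [mvnKernel_sq_comm a s t, abs_sub_comm s t] using this t s hts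
  have hpos : 0 < t - s := sub_pos.2 hst
  simp_rw [mvnKernel_eq_scaled hst, mul_pow]
  rw [integral_const_mul, integral_sub_right_eq_self
    (fun u => mvnKernel a 0 1 (u / (t - s)) ^ 2) s,
    Measure.integral_comp_div (fun u => mvnKernel a 0 1 u ^ 2), abs_sub_comm s t, abs_of_pos hpos,
    rpow_sq_eq hpos.le, Real.rpow_add_one hpos.ne', smul_eq_mul, mul_assoc]

theorem memLp_mvnKernel {a : ℝ} (ha : -1 < 2 * a) (ha' : 2 * a < 1) (s t : ℝ) :
    MemLp (mvnKernel a s t) 2 :=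
  (memLp_two_iff_integrable_sq (measurable_mvnKernel a s t).aestronglyMeasurable).2
    (integrable_mvnKernel_sq ha ha' s t)

/-- The kernels `mvnKernel a 0 s` realize the covariance of fractional Brownian motion with
Hurst parameter `a + 1 / 2`, up to a multiplicative constant. -/
theorem integral_mvnKernel_mul {a : ℝ} (ha : -1 < 2 * a) (ha' : 2 * a < 1) (s t : ℝ) :
    ∫ u, mvnKernel a 0 s u * mvnKernel a 0 t u =
      (∫ u, mvnKernel a 0 1 u ^ 2) *
        ((|s| ^ (2 * a + 1) + |t| ^ (2 * a + 1) - |s - t| ^ (2 * a + 1)) / 2) := by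
  have hpolar : ∀ u, mvnKernel a 0 s u * mvnKernel a 0 t u =
      (mvnKernel a 0 s u ^ 2 + mvnKernel a 0 t u ^ 2 - mvnKernel a s t u ^ 2) / 2 := fun u => by
    simp only [mvnKernel]; ring
  have hint := integrable_mvnKernel_sq ha ha'
  simp_rw [hpolar]
  rw [integral_div, integral_sub (by exact (hint 0 s).add (hint 0 t)) (hint s t),
    integral_add (hint 0 s) (hint 0 t), integral_mvnKernel_sq ha 0 s,
    integral_mvnKernel_sq ha 0 t, integral_mvnKernel_sq ha s t]
  simp only [zero_sub, abs_neg]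
  ring

theorem sq_mul_rpow_div_le_integral_sq {a r t y : ℝ} (ha : -1 < 2 * a) (hrt : r ≤ t) {F : ℝ → ℝ}
    (hF : Integrable fun u => F u ^ 2) (hFeq : ∀ u ∈ Ioo r t, F u = y * (t - u) ^ a) :
    (t - r) ^ (2 * a + 1) / (2 * a + 1) * y ^ 2 ≤ ∫ u, F u ^ 2 := by
  have hset : ∫ u in Ioo r t, F u ^ 2 = (t - r) ^ (2 * a + 1) / (2 * a + 1) * y ^ 2 := by
    rw [setIntegral_congr_fun (g := fun u => y ^ 2 * (t - u) ^ (2 * a)) measurableSet_Ioo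
      fun u hu => by
        simp only [hFeq u hu, mul_pow, rpow_sq_eq (sub_nonneg.2 hu.2.le)],
      integral_const_mul, ← integral_Ioc_eq_integral_Ioo,
      ← intervalIntegral.integral_of_le hrt,
      intervalIntegral.integral_comp_sub_left (fun x : ℝ => x ^ (2 * a)) t, sub_self,
      integral_rpow (Or.inl ha), Real.zero_rpow (by linarith), sub_zero, mul_comm]
  rw [← hset]
  exact setIntegral_le_integral hF (Filter.Eventually.of_forall fun u => sq_nonneg _)

theorem integral_mvnKernel_zero_one_sq_pos {a : ℝ} (ha : -1 < 2 * a) (ha' : 2 * a < 1) :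
    0 < ∫ u, mvnKernel a 0 1 u ^ 2 := by
  have h := sq_mul_rpow_div_le_integral_sq (y := 1) ha zero_le_one
    (integrable_mvnKernel_zero_one_sq ha ha') fun u hu => by
      rw [mvnKernel, truncPow_of_pos (sub_pos.2 hu.2),
        truncPow_of_nonpos (by linarith [hu.1]), sub_zero, one_mul]
  refine lt_of_lt_of_le ?_ h
  have : 0 < 2 * a + 1 := by linarith
  simpa using this

/-- The conditional variance of fractional Brownian motion at the last of finitely many times
given the earlier ones is at least a constant times a power of the last time increment. -/
theorem mul_sq_le_quadraticForm_fbm {H : ℝ} (hH : H ∈ Ioo (0 : ℝ) 1) {n : ℕ}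
    (s : Fin (n + 1) → ℝ) {r : ℝ} (hr : 0 ≤ r) (hs0 : ∀ i, 0 ≤ s i) (hrs : r ≤ s (Fin.last n))
    (hs : ∀ i : Fin n, s i.castSucc ≤ r) (x : Fin (n + 1) → ℝ) :
    ((2 * H * ∫ u, mvnKernel (H - 1 / 2) 0 1 u ^ 2)⁻¹ * (s (Fin.last n) - r) ^ (2 * H))
        * x (Fin.last n) ^ 2 ≤
      x ⬝ᵥ (Matrix.of fun i j =>
        (s i ^ (2 * H) + s j ^ (2 * H) - |s i - s j| ^ (2 * H)) / 2) *ᵥ x := by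
  have ha : -1 < 2 * (H - 1 / 2) := by linarith [hH.1]
  have ha' : 2 * (H - 1 / 2) < 1 := by linarith [hH.2]
  have hexp : 2 * (H - 1 / 2) + 1 = 2 * H := by ring
  have hK := integral_mvnKernel_zero_one_sq_pos ha ha'
  have hmem : MemLp (fun u => ∑ i, x i * mvnKernel (H - 1 / 2) 0 (s i) u) 2 :=
    memLp_finsetSum _ fun i _ => (memLp_mvnKernel ha ha' 0 (s i)).const_mul (x i)
  have hint : ∀ i j, Integrable fun u =>
      mvnKernel (H - 1 / 2) 0 (s i) u * mvnKernel (H - 1 / 2) 0 (s j) u := fun i j =>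
    (memLp_mvnKernel ha ha' 0 (s i)).integrable_mul (memLp_mvnKernel ha ha' 0 (s j))
  have hgram : ∫ u, (∑ i, x i * mvnKernel (H - 1 / 2) 0 (s i) u) ^ 2 =
      (∫ u, mvnKernel (H - 1 / 2) 0 1 u ^ 2) * (x ⬝ᵥ (Matrix.of fun i j =>
        (s i ^ (2 * H) + s j ^ (2 * H) - |s i - s j| ^ (2 * H)) / 2) *ᵥ x) := by
    have hexpand : ∀ u, (∑ i, x i * mvnKernel (H - 1 / 2) 0 (s i) u) ^ 2 =
        ∑ i, ∑ j, x i * x j *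
          (mvnKernel (H - 1 / 2) 0 (s i) u * mvnKernel (H - 1 / 2) 0 (s j) u) := fun u => by
      rw [sq, Finset.sum_mul_sum]
      exact Finset.sum_congr rfl fun i _ => Finset.sum_congr rfl fun j _ => by ring
    simp_rw [hexpand]
    rw [integral_finsetSum _ fun i _ => integrable_finsetSum _ fun j _ =>
      (hint i j).const_mul _]
    simp_rw [integral_finsetSum _ fun j _ => (hint _ j).const_mul _, integral_const_mul,
      integral_mvnKernel_mul ha ha', hexp, abs_of_nonneg (hs0 _)]
    simp only [dotProduct, mulVec, Matrix.of_apply, Finset.mul_sum]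
    exact Finset.sum_congr rfl fun i _ => Finset.sum_congr rfl fun j _ => by ring
  have hlower := sq_mul_rpow_div_le_integral_sq (y := x (Fin.last n)) ha hrs hmem.integrable_sq
    fun u hu => by
      have hu0 : 0 - u ≤ 0 := by linarith [hu.1]
      rw [Fin.sum_univ_castSucc, Finset.sum_eq_zero fun i _ => ?_, zero_add, mvnKernel,
        truncPow_of_pos (sub_pos.2 hu.2), truncPow_of_nonpos hu0, sub_zero]
      rw [mvnKernel, truncPow_of_nonpos (by linarith [hs i, hu.1]), truncPow_of_nonpos hu0,
        sub_zero, mul_zero]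
  rw [hgram, hexp] at hlower
  refine le_of_mul_le_mul_left (le_of_eq_of_le ?_ hlower) hK
  generalize ∫ u, mvnKernel (H - 1 / 2) 0 1 u ^ 2 = K at hK
  have := hH.1.ne'
  field_simp

/-- For `H ∈ (0,1)` there is `C = C(H) > 0`, independent of `n`, such that
for all times `0 = t 0 < t 1 < ⋯ < t n`, the determinant of the fBm covariance matrix
`Q_{jk} = (t_j^{2H} + t_k^{2H} - |t_j - t_k|^{2H})/2` (indices `1,…,n`) satisfies
`det Q ≥ Cⁿ ∏_j (t_j - t_{j-1})^{2H}`. -/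
theorem fbm_covariance_det_lower_bound
    (H : ℝ) (hH : H ∈ Set.Ioo (0:ℝ) 1) :
    ∃ C : ℝ, 0 < C ∧
      ∀ (n : ℕ), 1 ≤ n → ∀ t : ℕ → ℝ, t 0 = 0 → (∀ j < n, t j < t (j + 1)) →
        C ^ n * ∏ j : Fin n, (t ((j : ℕ) + 1) - t (j : ℕ)) ^ (2 * H) ≤
          (Matrix.of fun j k : Fin n =>
            ((t ((j : ℕ) + 1)) ^ (2 * H) + (t ((k : ℕ) + 1)) ^ (2 * H)
              - |t ((j : ℕ) + 1) - t ((k : ℕ) + 1)| ^ (2 * H)) / 2).det := by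
  have hK := integral_mvnKernel_zero_one_sq_pos (a := H - 1 / 2)
    (by linarith [hH.1]) (by linarith [hH.2])
  have hC : 0 < (2 * H * ∫ u, mvnKernel (H - 1 / 2) 0 1 u ^ 2)⁻¹ :=
    inv_pos.2 (mul_pos (mul_pos two_pos hH.1) hK)
  refine ⟨_, hC, ?_⟩
  rintro n - t ht0
  induction n with
  | zero => simp
  | succ n ih =>
    intro ht
    have hmono : ∀ j ≤ n + 1, ∀ i ≤ j, t i ≤ t j := by
      intro j hj i hij
      induction j, hij using Nat.le_induction with
      | base => exact le_rfl
      | succ j _ ihj => exact (ihj (by omega)).trans (ht j (by omega)).le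
    have hnonneg : ∀ j ≤ n + 1, 0 ≤ t j := fun j hj => ht0 ▸ hmono j hj 0 (Nat.zero_le j)
    have hform := mul_sq_le_quadraticForm_fbm hH (fun i : Fin (n + 1) => t ((i : ℕ) + 1))
      (hnonneg n n.le_succ) (fun i => hnonneg _ i.isLt) (ht n n.lt_succ_self).le
      (fun i => hmono n n.le_succ _ i.isLt)
    have hdet := mul_det_submatrix_castSucc_le_det (by
      ext i j
      simp only [transpose_apply, Matrix.of_apply, abs_sub_comm]
      ring) hform
    refine le_trans ?_ hdet
    have hn := ih (fun j hj => ht j (by omega))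
    rw [Fin.prod_univ_castSucc, pow_succ]
    refine le_of_eq_of_le ?_ (mul_le_mul_of_nonneg_left hn
      (mul_nonneg hC.le (Real.rpow_nonneg (sub_nonneg.2 (ht n n.lt_succ_self).le) (2 * H))))
    simp only [Fin.val_castSucc, Fin.val_last]
    ring
end

section
/- Let $H_1, H_2 \in (0,1)$, $T > 0$, and $a > 0$. If $\frac{H_1 H_2}{H_1 + H_2}\, a < 1$, then $\int_0^T \int_0^T \big(t^{2H_1} + s^{2H_2}\big)^{-a/2}\, dt\, ds < \infty$. -/
open MeasureTheory Set

/-- A weighted AM-GM bound: a sum of nonnegative numbers dominates any of their weighted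
geometric means. -/
lemma rpow_mul_rpow_le_add {x y u v : ℝ} (hx : 0 ≤ x) (hy : 0 ≤ y) (hu : 0 ≤ u) (hv : 0 ≤ v)
    (huv : u + v = 1) : x ^ u * y ^ v ≤ x + y := by
  have h := Real.geom_mean_le_arith_mean2_weighted hu hv hx hy huv
  nlinarith [mul_nonneg hv hx, mul_nonneg hu hy]

/-- For positive `t` and `s`, `(t^{2H₁} + s^{2H₂})^{-a/2}` is at most a product of equal powers of `t` and `s`. -/
lemma add_rpow_neg_le_mul_rpow {H₁ H₂ a t s : ℝ} (hH₁ : 0 < H₁) (hH₂ : 0 < H₂) (ha : 0 ≤ a)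
    (ht : 0 < t) (hs : 0 < s) :
    (t ^ (2 * H₁) + s ^ (2 * H₂)) ^ (-a / 2) ≤
      t ^ (-(H₁ * H₂ / (H₁ + H₂) * a)) * s ^ (-(H₁ * H₂ / (H₁ + H₂) * a)) := by
  have hsum : H₁ + H₂ ≠ 0 := by positivity
  have hle := rpow_mul_rpow_le_add (x := t ^ (2 * H₁)) (y := s ^ (2 * H₂))
    (u := H₂ / (H₁ + H₂)) (v := H₁ / (H₁ + H₂)) (by positivity) (by positivity)
    (by positivity) (by positivity) (by field_simp; ring)
  refine (Real.rpow_le_rpow_of_nonpos (by positivity) hle (by linarith)).trans_eq ?_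
  rw [Real.mul_rpow (by positivity) (by positivity), ← Real.rpow_mul ht.le, ← Real.rpow_mul hs.le,
    ← Real.rpow_mul ht.le, ← Real.rpow_mul hs.le]
  congr 2 <;> field_simp

/-- The power `t ^ r` with `r > -1` has finite integral over `(0, T]`. -/
lemma lintegral_Ioc_rpow_lt_top {r T : ℝ} (hr : -1 < r) (hT : 0 ≤ T) :
    ∫⁻ t in Ioc 0 T, ENNReal.ofReal (t ^ r) < ⊤ :=
  ((intervalIntegrable_iff_integrableOn_Ioc_of_le hT).1
    (intervalIntegral.intervalIntegrable_rpow' hr)).lintegral_lt_top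

/-- If `H₁H₂/(H₁+H₂) · a < 1`, then
`∫_0^T ∫_0^T (t^{2H₁} + s^{2H₂})^{-a/2} dt ds < ∞`. -/
theorem double_time_integral_finite
    (H₁ H₂ : ℝ) (hH₁ : H₁ ∈ Set.Ioo (0:ℝ) 1) (hH₂ : H₂ ∈ Set.Ioo (0:ℝ) 1)
    (T : ℝ) (hT : 0 < T) (a : ℝ) (ha : 0 < a)
    (hcond : H₁ * H₂ / (H₁ + H₂) * a < 1) :
    ∫⁻ p in Set.Ioc (0:ℝ) T ×ˢ Set.Ioc (0:ℝ) T,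
      ENNReal.ofReal ((p.1 ^ (2 * H₁) + p.2 ^ (2 * H₂)) ^ (-a / 2)) < ⊤ := by
  set c := H₁ * H₂ / (H₁ + H₂) * a
  have hfin := lintegral_Ioc_rpow_lt_top (r := -c) (by linarith) hT.le
  have hmeas : Measurable fun t : ℝ ↦ ENNReal.ofReal (t ^ (-c)) := by fun_prop
  calc
    _ ≤ ∫⁻ p in Ioc (0:ℝ) T ×ˢ Ioc (0:ℝ) T,
        ENNReal.ofReal (p.1 ^ (-c)) * ENNReal.ofReal (p.2 ^ (-c)) := by
      refine setLIntegral_mono' (measurableSet_Ioc.prod measurableSet_Ioc) fun p hp ↦ ?_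
      have h₁ : 0 < p.1 := hp.1.1
      rw [← ENNReal.ofReal_mul (by positivity)]
      exact ENNReal.ofReal_le_ofReal
        (add_rpow_neg_le_mul_rpow hH₁.1 hH₂.1 ha.le h₁ hp.2.1)
    _ = (∫⁻ t in Ioc 0 T, ENNReal.ofReal (t ^ (-c))) *
        ∫⁻ s in Ioc 0 T, ENNReal.ofReal (s ^ (-c)) := by
      rw [Measure.volume_eq_prod, ← Measure.prod_restrict]
      exact lintegral_prod_mul hmeas.aemeasurable hmeas.aemeasurable
    _ < ⊤ := ENNReal.mul_lt_top hfin hfin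
end

section
/- Let $H_1, H_2 \in (0,1)$, $T > 0$, and $a > 0$. If $\frac{H_1 H_2}{H_1 + H_2}\, a \ge 1$, then $\int_0^T \int_0^T \big(t^{2H_1} + s^{2H_2}\big)^{-a/2}\, dt\, ds = \infty$. -/
open MeasureTheory Set

lemma lintegral_Ioo_rpow_eq_top {r δ : ℝ} (hr : r ≤ -1) (hδ : 0 < δ) :
    ∫⁻ t in Ioo (0:ℝ) δ, ENNReal.ofReal (t ^ r) = ⊤ := by
  by_contra h
  have hint : IntegrableOn (fun t : ℝ => t ^ r) (Ioo 0 δ) := by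
    refine ⟨(by fun_prop : Measurable fun t : ℝ => t ^ r).aestronglyMeasurable, ?_⟩
    rw [hasFiniteIntegral_iff_ofReal]
    · exact lt_top_iff_ne_top.2 h
    · filter_upwards [ae_restrict_mem measurableSet_Ioo] with t ht
      exact Real.rpow_nonneg ht.1.le r
  rw [intervalIntegral.integrableOn_Ioo_rpow_iff hδ] at hint
  linarith

/-- Below the curve `s = t ^ (H₁ / H₂)` the integrand is at least `2 ^ (-a / 2) * t ^ (-a * H₁)`. -/
lemma rpow_le_add_rpow_of_le {H₁ H₂ a t s : ℝ} (hH₂ : 0 < H₂) (ha : 0 < a)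
    (ht : 0 < t) (hs : 0 < s) (hst : s ≤ t ^ (H₁ / H₂)) :
    2 ^ (-a / 2) * t ^ (-a * H₁) ≤ (t ^ (2 * H₁) + s ^ (2 * H₂)) ^ (-a / 2) := by
  have hle : s ^ (2 * H₂) ≤ t ^ (2 * H₁) := by
    calc s ^ (2 * H₂) ≤ (t ^ (H₁ / H₂)) ^ (2 * H₂) := by gcongr
      _ = t ^ (2 * H₁) := by
        rw [← Real.rpow_mul ht.le]
        congr 1
        field_simp
  have hpow : t ^ (-a * H₁) = (t ^ (2 * H₁)) ^ (-a / 2) := by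
    rw [← Real.rpow_mul ht.le]
    ring_nf
  rw [hpow, ← Real.mul_rpow zero_le_two (Real.rpow_nonneg ht.le _)]
  exact Real.rpow_le_rpow_of_nonpos (by positivity) (by linarith) (by linarith)

lemma le_lintegral_slice {H₁ H₂ a T t : ℝ} (hH₂ : 0 < H₂) (ha : 0 < a)
    (ht : 0 < t) (htT : t ^ (H₁ / H₂) ≤ T) :
    ENNReal.ofReal (2 ^ (-a / 2)) * ENNReal.ofReal (t ^ (H₁ / H₂ - a * H₁)) ≤
      ∫⁻ s in Ioc (0:ℝ) T, ENNReal.ofReal ((t ^ (2 * H₁) + s ^ (2 * H₂)) ^ (-a / 2)) := by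
  calc _ = ∫⁻ _ in Ioc (0:ℝ) (t ^ (H₁ / H₂)),
        ENNReal.ofReal (2 ^ (-a / 2) * t ^ (-a * H₁)) := by
        rw [setLIntegral_const, Real.volume_Ioc, sub_zero,
          ← ENNReal.ofReal_mul (by positivity), ← ENNReal.ofReal_mul (by positivity),
          mul_assoc, ← Real.rpow_add ht]
        ring_nf
    _ ≤ ∫⁻ s in Ioc (0:ℝ) (t ^ (H₁ / H₂)),
        ENNReal.ofReal ((t ^ (2 * H₁) + s ^ (2 * H₂)) ^ (-a / 2)) :=
      setLIntegral_mono' measurableSet_Ioc fun s hs =>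
        ENNReal.ofReal_le_ofReal (rpow_le_add_rpow_of_le hH₂ ha ht hs.1 hs.2)
    _ ≤ _ := lintegral_mono_set (Ioc_subset_Ioc_right htT)

/-- If `H₁H₂/(H₁+H₂) · a ≥ 1`, then
`∫_0^T ∫_0^T (t^{2H₁} + s^{2H₂})^{-a/2} dt ds = ∞`. -/
theorem double_time_integral_infinite
    (H₁ H₂ : ℝ) (hH₁ : H₁ ∈ Set.Ioo (0:ℝ) 1) (hH₂ : H₂ ∈ Set.Ioo (0:ℝ) 1)
    (T : ℝ) (hT : 0 < T) (a : ℝ) (ha : 0 < a)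
    (hcond : 1 ≤ H₁ * H₂ / (H₁ + H₂) * a) :
    ∫⁻ p in Set.Ioc (0:ℝ) T ×ˢ Set.Ioc (0:ℝ) T,
      ENNReal.ofReal ((p.1 ^ (2 * H₁) + p.2 ^ (2 * H₂)) ^ (-a / 2)) = ⊤ := by
  have h₁ := hH₁.1
  have h₂ := hH₂.1
  have hexp : H₁ / H₂ - a * H₁ ≤ -1 := by
    rw [div_mul_eq_mul_div, le_div_iff₀ (by positivity)] at hcond
    rw [sub_le_iff_le_add, div_le_iff₀ h₂]
    linarith
  set δ : ℝ := min T (T ^ (H₂ / H₁))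
  have hδ : 0 < δ := lt_min hT (Real.rpow_pos_of_pos hT _)
  have hcurve : ∀ t ∈ Ioo (0:ℝ) δ, t ^ (H₁ / H₂) ≤ T := fun t ht => by
    calc t ^ (H₁ / H₂) ≤ (T ^ (H₂ / H₁)) ^ (H₁ / H₂) :=
          Real.rpow_le_rpow ht.1.le (ht.2.le.trans (min_le_right _ _)) (by positivity)
      _ = T := by
        rw [← Real.rpow_mul hT.le, div_mul_div_cancel₀ h₁.ne', div_self h₂.ne', Real.rpow_one]
  rw [Measure.volume_eq_prod, ← Measure.prod_restrict, lintegral_prod _ (by fun_prop), eq_top_iff]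
  calc (⊤ : ENNReal) = ENNReal.ofReal (2 ^ (-a / 2)) *
        ∫⁻ t in Ioo (0:ℝ) δ, ENNReal.ofReal (t ^ (H₁ / H₂ - a * H₁)) := by
        rw [lintegral_Ioo_rpow_eq_top hexp hδ, ENNReal.mul_top]
        exact (ENNReal.ofReal_pos.2 (by positivity)).ne'
    _ = ∫⁻ t in Ioo (0:ℝ) δ, ENNReal.ofReal (2 ^ (-a / 2)) *
        ENNReal.ofReal (t ^ (H₁ / H₂ - a * H₁)) :=
      (lintegral_const_mul _ (by fun_prop)).symm
    _ ≤ ∫⁻ t in Ioo (0:ℝ) δ, ∫⁻ s in Ioc (0:ℝ) T,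
        ENNReal.ofReal ((t ^ (2 * H₁) + s ^ (2 * H₂)) ^ (-a / 2)) :=
      setLIntegral_mono' measurableSet_Ioo fun t ht => le_lintegral_slice h₂ ha ht.1 (hcurve t ht)
    _ ≤ _ := lintegral_mono_set
      (Ioo_subset_Ioc_self.trans (Ioc_subset_Ioc_right (min_le_left _ _)))
end
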